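/- arXiv:1105.3879 — 2 statements merged into one kernel-verified Lean document; each statement's English description precedes it below -/
import Mathlib

section
/- Let H be an r × n matrix over 𝔽₂ and let d⊥ be the minimum Hamming weight of a nonzero element of the row space of H. Let C = {x ∈ 𝔽₂ⁿ : Hx = 0}. Then for every subset S ⊆ {1,…,n} with |S| < d⊥ and every assignment y : S → 𝔽₂, there exists a codeword x ∈ C with x_i = y_i for all i ∈ S. (The projection of C onto any fewer than d⊥ coordinates is surjective.) -/
/-- If every nonzero row combination of `H` has Hamming weight greater than `|S|`, then every vector
agrees on `S` with a vector in the kernel of `H`. -/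
theorem Matrix.exists_mulVec_eq_zero_eqOn {K m n : Type*} [Field K] [DecidableEq K] [Fintype m]
    [Fintype n] (H : Matrix m n K) (S : Finset n)
    (hH : ∀ u : m → K, Matrix.vecMul u H ≠ 0 → S.card < hammingNorm (Matrix.vecMul u H))
    (y : n → K) :
    ∃ x : n → K, H.mulVec x = 0 ∧ ∀ i ∈ S, x i = y i := by
  classical
  let W : Submodule K (m → K) := (Submodule.pi (S : Set n) fun _ => ⊥).map H.mulVecLin
  suffices hy : H.mulVec y ∈ W by
    obtain ⟨z, hz, hzy⟩ := hy
    refine ⟨y - z, ?_, fun i hi => ?_⟩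
    · rw [Matrix.mulVec_sub, sub_eq_zero]
      exact hzy.symm
    · have hzi : z i = 0 := hz i hi
      simp [hzi]
  by_contra hy
  obtain ⟨f, hfy, hfW⟩ := W.exists_le_ker_of_notMem hy
  obtain ⟨u, rfl⟩ := (dotProductEquiv K m).surjective f
  have hf (x : n → K) : dotProductEquiv K m u (H.mulVec x) = Matrix.vecMul u H ⬝ᵥ x :=
    Matrix.dotProduct_mulVec u H x
  have hu : ∀ j ∉ S, Matrix.vecMul u H j = 0 := by
    intro j hj
    have hmem : H.mulVec (Pi.single j 1) ∈ W := by
      refine ⟨Pi.single j 1, fun i hi => ?_, rfl⟩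
      exact Pi.single_eq_of_ne (ne_of_mem_of_not_mem hi hj) 1
    have hker := hfW hmem
    rwa [LinearMap.mem_ker, hf, dotProduct_single_one] at hker
  have hu0 : Matrix.vecMul u H = 0 := by
    by_contra hne
    refine (hH u hne).not_ge (Finset.card_le_card fun j hj => ?_)
    by_contra hjS
    exact (Finset.mem_filter.1 hj).2 (hu j hjS)
  exact hfy (by rw [hf, hu0, zero_dotProduct])


/-- **Projection of a code onto fewer than `d⊥` coordinates is surjective.**

`H` is an `r × n` matrix over `𝔽₂`, `C = {x : H x = 0}` is the code with
parity-check matrix `H`, and `dperp` is a lower bound on the Hamming weight of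
the nonzero elements of the row space of `H` (the dual code `C⊥`).  Then for
every subset `S` of positions with `|S| < dperp` and every assignment
`y : S → 𝔽₂`, there is a codeword `x ∈ C` with `x i = y i` for all `i ∈ S`. -/
theorem code_projection_surjective
    {r n : ℕ} (H : Matrix (Fin r) (Fin n) (ZMod 2)) (dperp : ℕ)
    (hd : ∀ y : Fin r → ZMod 2, Matrix.vecMul y H ≠ 0 →
      dperp ≤ hammingNorm (Matrix.vecMul y H))
    (S : Finset (Fin n)) (hS : S.card < dperp)
    (y : Fin n → ZMod 2) :
    ∃ x : Fin n → ZMod 2, H.mulVec x = 0 ∧ ∀ i ∈ S, x i = y i := by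
  exact H.exists_mulVec_eq_zero_eqOn S (fun u hu => hS.trans_le (hd u hu)) y
end

section
/- Let H be an r × n matrix over 𝔽₂ of rank r with columns h₁,…,hₙ, and let d⊥ be the minimum Hamming weight of a nonzero element of the row space of H. Then for every subset S ⊆ {1,…,n} with |S| < d⊥, all messages m, m' ∈ 𝔽₂^r, and every t ∈ 𝔽₂^r, the number of x ∈ 𝔽₂ⁿ with Hx = m and Σ_{i∈S} x_i·h_i = t equals the number of x ∈ 𝔽₂ⁿ with Hx = m' and Σ_{i∈S} x_i·h_i = t. (The partial syndrome Σ_{i∈S} h_i·x_i of a uniformly random encoding is distributed independently of the encoded message.) -/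
/-- If every nonzero element of the row space of `H` has Hamming weight larger than `|S|`, then
the columns of `H` outside `S` already span the column space. -/
theorem Matrix.exists_mulVec_eq_of_card_lt_hammingNorm {K m n : Type*} [Field K] [DecidableEq K]
    [Fintype m] [Fintype n] (H : Matrix m n K)
    (hH : Function.Surjective H.mulVec) (S : Finset n)
    (hS : ∀ y : m → K, Matrix.vecMul y H ≠ 0 → S.card < hammingNorm (Matrix.vecMul y H))
    (v : m → K) : ∃ z : n → K, (∀ i ∈ S, z i = 0) ∧ H.mulVec z = v := by
  classical
  let W : Submodule K (m → K) :=
    (Submodule.pi (S : Set n) fun _ => (⊥ : Submodule K K)).map H.mulVecLin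
  suffices hW : W = ⊤ by
    obtain ⟨z, hz, hzv⟩ : v ∈ W := hW ▸ Submodule.mem_top
    exact ⟨z, fun i hi => (Submodule.mem_bot K).1 (hz i hi), hzv⟩
  by_contra hW
  obtain ⟨f, hf, hWf⟩ := W.exists_le_ker_of_lt_top (lt_top_iff_ne_top.2 hW)
  obtain ⟨y, rfl⟩ := (dotProductEquiv K m).surjective f
  have hy : Matrix.vecMul y H ≠ 0 := by
    intro h
    refine hf (LinearMap.ext fun w => ?_)
    obtain ⟨x, rfl⟩ := hH w
    simp [Matrix.dotProduct_mulVec, h]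
  refine (hS y hy).not_ge (Finset.card_le_card fun i hi => ?_)
  by_contra hiS
  have hmem : H.mulVec (Pi.single i 1) ∈ W := by
    refine ⟨Pi.single i 1, fun j hj => ?_, rfl⟩
    have hji : j ≠ i := by rintro rfl; exact hiS hj
    exact (Submodule.mem_bot K).2 (Pi.single_eq_of_ne hji 1)
  have h0 := hWf hmem
  rw [LinearMap.mem_ker, dotProductEquiv_apply_apply, Matrix.dotProduct_mulVec,
    dotProduct_single_one] at h0
  simp [h0] at hi


/-- **The partial syndrome is distributed independently of the message.**

`H` is an `r × n` matrix over `𝔽₂` of rank `r` (`x ↦ H x` surjective) with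
columns `h i = Hᵀ i`, and `dperp` is a lower bound on the Hamming weight of
the nonzero elements of the row space of `H`.  Then for every subset `S` of
positions with `|S| < dperp`, all messages `m, m' ∈ 𝔽₂^r`, and every target
`t ∈ 𝔽₂^r`, the number of `x` with `H x = m` and `∑_{i ∈ S} x i • h i = t`
equals the number of `x` with `H x = m'` and `∑_{i ∈ S} x i • h i = t`. -/
theorem partial_syndrome_independent
    {r n : ℕ} (H : Matrix (Fin r) (Fin n) (ZMod 2)) (dperp : ℕ)
    (hd : ∀ y : Fin r → ZMod 2, Matrix.vecMul y H ≠ 0 →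
      dperp ≤ hammingNorm (Matrix.vecMul y H))
    (hrank : Function.Surjective (fun x : Fin n → ZMod 2 => H.mulVec x))
    (S : Finset (Fin n)) (hS : S.card < dperp)
    (m m' t : Fin r → ZMod 2) :
    Nat.card {x : Fin n → ZMod 2 //
        H.mulVec x = m ∧ ∑ i ∈ S, x i • H.transpose i = t}
      = Nat.card {x : Fin n → ZMod 2 //
        H.mulVec x = m' ∧ ∑ i ∈ S, x i • H.transpose i = t} := by
  obtain ⟨z, hzS, hz⟩ := H.exists_mulVec_eq_of_card_lt_hammingNorm hrank S
    (fun y hy => hS.trans_le (hd y hy)) (m' - m)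
  refine Nat.card_congr ((Equiv.addRight z).subtypeEquiv fun x => and_congr ?_ ?_)
  · rw [Equiv.coe_addRight, Matrix.mulVec_add, hz, ← eq_sub_iff_add_eq, sub_sub_cancel]
  · rw [Finset.sum_congr rfl fun i hi => ?_]
    simp [hzS i hi]
end
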